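/- Set M₃ = max{M₂, a₁, a₂} and suppose 0 < α < min{λ₁/M₃, λ₂/M₃}. Let C > 0 be given. If ε > 0 is sufficiently small so that 0 < α < min{λ₁/(M₃ + K₂ε), λ₂/(M₃ + K₁ε)} and 2^{1+α} M ε^α [D₁/(λ₁ − α(M₃ + K₂ε)) + D₂/(λ₂ − α(M₃ + K₁ε))] ≤ C, then the map h̄ from the conjugacy H̄(t,x,y) = (x + h̄(t,x,y), y) satisfies |h̄(t,x,y₁) − h̄(t,x,y₂)| ≤ C |y₁ − y₂|^α for all t ∈ ℝ, x ∈ X and y₁, y₂ ∈ Y. -/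

import Mathlib

open MeasureTheory Real

/-- `X = ℝ^d` with the Euclidean norm. -/
abbrev Euc (d : ℕ) := EuclideanSpace ℝ (Fin d)

/-- The Green function `𝒢(t,s)`. -/
noncomputable def Green {X : Type*} [NormedAddCommGroup X] [NormedSpace ℝ X]
    (T : ℝ → ℝ → X →L[ℝ] X) (P : ℝ → X →L[ℝ] X) (t s : ℝ) : X →L[ℝ] X :=
  if s ≤ t then (T t s).comp (P s)
  else -((T t s).comp (ContinuousLinearMap.id ℝ X - P s))

/-- `T` is the evolution family of `ẋ = A(t)x`. -/
def IsEvolutionFamily {X : Type*} [NormedAddCommGroup X] [NormedSpace ℝ X]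
    (A : ℝ → X →L[ℝ] X) (T : ℝ → ℝ → X →L[ℝ] X) : Prop :=
  (∀ s ξ t, HasDerivAt (fun r => T r s ξ) (A t (T t s ξ)) t) ∧
  (∀ s, T s s = ContinuousLinearMap.id ℝ X) ∧
  (∀ t r s, (T t r).comp (T r s) = T t s)

/-- `(x, y)` is a solution of the coupled system `ẋ = A(t)x + f(t,x,y)`, `ẏ = g(t,y)`. -/
def IsSolNL {X Y : Type*} [NormedAddCommGroup X] [NormedSpace ℝ X]
    [NormedAddCommGroup Y] [NormedSpace ℝ Y]
    (A : ℝ → X →L[ℝ] X) (f : ℝ → X → Y → X) (g : ℝ → Y → Y)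
    (x : ℝ → X) (y : ℝ → Y) : Prop :=
  (∀ t, HasDerivAt x (A t (x t) + f t (x t) (y t)) t) ∧
  (∀ t, HasDerivAt y (g t (y t)) t)

section Helpers

open Set Filter Topology

/-- Integral form of Grönwall's inequality. -/
lemma le_mul_exp_of_le_add_mul_integral {v : ℝ → ℝ} {δ k : ℝ} (hv : Continuous v)
    (hv0 : ∀ r, 0 ≤ v r) (hδ : 0 ≤ δ) (hk : 0 ≤ k)
    (h : ∀ τ, 0 ≤ τ → v τ ≤ δ + k * ∫ r in (0 : ℝ)..τ, v r) {τ : ℝ} (hτ : 0 ≤ τ) :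
    v τ ≤ δ * exp (k * τ) := by
  have hderiv : ∀ x, HasDerivAt (fun τ => δ + k * ∫ r in (0 : ℝ)..τ, v r) (k * v x) x := fun x =>
    ((intervalIntegral.integral_hasDerivAt_right (hv.intervalIntegrable _ _)
      (hv.stronglyMeasurableAtFilter _ _) hv.continuousAt).const_mul k).const_add δ
  have hU0 : ∀ x, 0 ≤ x → 0 ≤ δ + k * ∫ r in (0 : ℝ)..x, v r := fun x hx =>
    add_nonneg hδ (mul_nonneg hk (intervalIntegral.integral_nonneg hx fun u _ => hv0 u))
  have key := norm_le_gronwallBound_of_norm_deriv_right_le (a := 0) (b := τ) (δ := δ) (K := k)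
    (ε := 0) (f := fun τ => δ + k * ∫ r in (0 : ℝ)..τ, v r) (f' := fun x => k * v x)
    (fun x _ => (hderiv x).continuousAt.continuousWithinAt)
    (fun x _ => (hderiv x).hasDerivWithinAt) (by simp [abs_of_nonneg hδ])
    (fun x hx => by
      rw [norm_of_nonneg (mul_nonneg hk (hv0 x)), norm_of_nonneg (hU0 x hx.1), add_zero]
      exact mul_le_mul_of_nonneg_left (h x hx.1) hk) τ ⟨hτ, le_rfl⟩
  rw [gronwallBound_ε0, norm_of_nonneg (hU0 τ hτ), sub_zero] at key
  exact (h τ hτ).trans key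

/-- Solutions of a Lipschitz equation separate at most exponentially; the sign `σ` selects the
direction of time. -/
lemma norm_sub_le_exp_of_hasDerivAt {Y : Type*} [NormedAddCommGroup Y] [NormedSpace ℝ Y]
    {g : ℝ → Y → Y} {L : ℝ} (hg : ∀ t y w, ‖g t y - g t w‖ ≤ L * ‖y - w‖)
    {y w : ℝ → Y} (hy : ∀ t, HasDerivAt y (g t (y t)) t) (hw : ∀ t, HasDerivAt w (g t (w t)) t)
    {σ : ℝ} (hσ : |σ| = 1) (t : ℝ) {τ : ℝ} (hτ : 0 ≤ τ) :
    ‖y (t + σ * τ) - w (t + σ * τ)‖ ≤ ‖y t - w t‖ * exp (L * τ) := by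
  have haff : ∀ r, HasDerivAt (fun r : ℝ => t + σ * r) σ r := fun r => by
    simpa using ((hasDerivAt_id r).const_mul σ).const_add t
  have hd : ∀ r, HasDerivAt (fun r => y (t + σ * r) - w (t + σ * r))
      (σ • g (t + σ * r) (y (t + σ * r)) - σ • g (t + σ * r) (w (t + σ * r))) r := fun r =>
    (HasDerivAt.scomp r (hy _) (haff r)).sub (HasDerivAt.scomp r (hw _) (haff r))
  have key := norm_le_gronwallBound_of_norm_deriv_right_le (a := 0) (b := τ) (K := L)
    (δ := ‖y t - w t‖) (ε := 0)
    (fun x _ => (hd x).continuousAt.continuousWithinAt)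
    (fun x _ => (hd x).hasDerivWithinAt) (by simp)
    (fun x _ => by
      rw [← smul_sub, norm_smul, norm_eq_abs, hσ, one_mul, add_zero]
      exact hg _ _ _) τ ⟨hτ, le_rfl⟩
  rwa [gronwallBound_ε0, sub_zero] at key

variable {X : Type*} [NormedAddCommGroup X] [NormedSpace ℝ X]
  {A : ℝ → X →L[ℝ] X} {T : ℝ → ℝ → X →L[ℝ] X}

lemma IsEvolutionFamily.continuous_right [FiniteDimensional ℝ X] (hT : IsEvolutionFamily A T)
    (t : ℝ) : Continuous fun s => T t s := by
  have : CompleteSpace X := FiniteDimensional.complete ℝ X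
  obtain ⟨h1, h2, h3⟩ := hT
  have hl : Continuous fun s => T s t :=
    continuous_clm_apply.2 fun ξ =>
      continuous_iff_continuousAt.2 fun s => (h1 t ξ s).continuousAt
  let U : ℝ → (X →L[ℝ] X)ˣ := fun s =>
    ⟨T s t, T t s, by rw [ContinuousLinearMap.mul_def, h3, h2]; rfl,
      by rw [ContinuousLinearMap.mul_def, h3, h2]; rfl⟩
  have hU : (fun s => T t s) = fun s => Ring.inverse (T s t) := by
    funext s
    exact (Ring.inverse_unit (U s)).symm
  rw [hU]
  exact continuous_iff_continuousAt.2 fun s =>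
    ContinuousAt.comp (f := fun s => T s t) (NormedRing.inverse_continuousAt (U s))
      hl.continuousAt

/-- Pulling a solution of the inhomogeneous linear equation back to a fixed time removes the
linear part. -/
lemma IsEvolutionFamily.hasDerivAt_pullback [FiniteDimensional ℝ X]
    (hT : IsEvolutionFamily A T) {z : ℝ → X} {r₀ : ℝ} {F : X}
    (hz : HasDerivAt z (A r₀ (z r₀) + F) r₀) (s : ℝ) :
    HasDerivAt (fun r => T s r (z r)) (T s r₀ F) r₀ := by
  have hd : HasDerivAt (fun r => z r - T r r₀ (z r₀)) F r₀ := by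
    refine (hz.sub (hT.1 r₀ (z r₀) r₀)).congr_deriv ?_
    simp [hT.2.1]
  rw [hasDerivAt_iff_tendsto_slope] at hd ⊢
  have hc : Tendsto (fun r => T s r) (𝓝[≠] r₀) (𝓝 (T s r₀)) :=
    (hT.continuous_right s).continuousAt.tendsto.mono_left nhdsWithin_le_nhds
  refine ((isBoundedBilinearMap_apply.continuous.tendsto _).comp (hc.prodMk_nhds hd)).congr fun r => ?_
  have h3 : T s r (T r r₀ (z r₀)) = T s r₀ (z r₀) := by
    rw [← hT.2.2 s r r₀]; rfl
  simp [slope_def_module, hT.2.1, h3]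

/-- Variation of constants. -/
lemma IsEvolutionFamily.eq_integral_of_hasDerivAt [FiniteDimensional ℝ X]
    (hT : IsEvolutionFamily A T) {z F : ℝ → X}
    (hz : ∀ t, HasDerivAt z (A t (z t) + F t) t) (hF : Continuous F) {t : ℝ} (h0 : z t = 0)
    (σ τ : ℝ) :
    z (t + σ * τ) = ∫ r in (0 : ℝ)..τ, σ • T (t + σ * τ) (t + σ * r) (F (t + σ * r)) := by
  have : CompleteSpace X := FiniteDimensional.complete ℝ X
  have haff : ∀ r, HasDerivAt (fun r : ℝ => t + σ * r) σ r := fun r => by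
    simpa using ((hasDerivAt_id r).const_mul σ).const_add t
  have hcont : Continuous fun r : ℝ => t + σ * r := by fun_prop
  have hi : Continuous fun r => σ • T (t + σ * τ) (t + σ * r) (F (t + σ * r)) :=
    (((hT.continuous_right (t + σ * τ)).comp hcont).clm_apply (hF.comp hcont)).const_smul σ
  rw [intervalIntegral.integral_eq_sub_of_hasDerivAt
    (f := fun r => T (t + σ * τ) (t + σ * r) (z (t + σ * r)))
    (fun r _ => HasDerivAt.scomp r (hT.hasDerivAt_pullback (hz _) (t + σ * τ)) (haff r))
    (hi.intervalIntegrable _ _)]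
  simp [h0, hT.2.1]

/-- Two solutions of the coupled system with the same initial `x`-component separate at most
exponentially; the sign `σ` selects the direction of time. -/
lemma IsEvolutionFamily.norm_sub_add_norm_sub_le [FiniteDimensional ℝ X]
    {Y : Type*} [NormedAddCommGroup Y] [NormedSpace ℝ Y]
    (hT : IsEvolutionFamily A T) {f : ℝ → X → Y → X} {g : ℝ → Y → Y}
    (hf : Continuous fun p : ℝ × X × Y => f p.1 p.2.1 p.2.2) {ε : ℝ} (hε : 0 ≤ ε)
    (hfl : ∀ t x₁ x₂ y₁ y₂, ‖f t x₁ y₁ - f t x₂ y₂‖ ≤ ε * (‖x₁ - x₂‖ + ‖y₁ - y₂‖))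
    {L : ℝ} (hgl : ∀ t y w, ‖g t y - g t w‖ ≤ L * ‖y - w‖)
    {x₁ x₂ : ℝ → X} {y₁ y₂ : ℝ → Y} (h₁ : IsSolNL A f g x₁ y₁) (h₂ : IsSolNL A f g x₂ y₂)
    {t : ℝ} (h0 : x₁ t = x₂ t) {σ : ℝ} (hσ : |σ| = 1) {K a m : ℝ} (hK : 0 ≤ K)
    (ham : a ≤ m) (hLm : L ≤ m)
    (hTb : ∀ r τ, r ≤ τ → ‖T (t + σ * τ) (t + σ * r)‖ ≤ K * exp (a * (τ - r)))
    {τ : ℝ} (hτ : 0 ≤ τ) :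
    ‖x₁ (t + σ * τ) - x₂ (t + σ * τ)‖ + ‖y₁ (t + σ * τ) - y₂ (t + σ * τ)‖
      ≤ ‖y₁ t - y₂ t‖ * exp ((m + K * ε) * τ) := by
  set δ := ‖y₁ t - y₂ t‖ with hδ
  have hδ0 : 0 ≤ δ := norm_nonneg _
  have cx₁ : Continuous x₁ := continuous_iff_continuousAt.2 fun s => (h₁.1 s).continuousAt
  have cx₂ : Continuous x₂ := continuous_iff_continuousAt.2 fun s => (h₂.1 s).continuousAt
  have cy₁ : Continuous y₁ := continuous_iff_continuousAt.2 fun s => (h₁.2 s).continuousAt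
  have cy₂ : Continuous y₂ := continuous_iff_continuousAt.2 fun s => (h₂.2 s).continuousAt
  have hy : ∀ r, 0 ≤ r → ‖y₁ (t + σ * r) - y₂ (t + σ * r)‖ ≤ δ * exp (m * r) := fun r hr =>
    (norm_sub_le_exp_of_hasDerivAt hgl h₁.2 h₂.2 hσ t hr).trans (by gcongr)
  set F : ℝ → X := fun s => f s (x₁ s) (y₁ s) - f s (x₂ s) (y₂ s) with hF
  have cF : Continuous F :=
    (hf.comp (continuous_id.prodMk (cx₁.prodMk cy₁))).sub
      (hf.comp (continuous_id.prodMk (cx₂.prodMk cy₂)))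
  have hz : ∀ s, HasDerivAt (fun s => x₁ s - x₂ s) (A s (x₁ s - x₂ s) + F s) s := fun s => by
    refine ((h₁.1 s).sub (h₂.1 s)).congr_deriv ?_
    simp only [hF, map_sub]
    abel
  have haff : Continuous fun r : ℝ => t + σ * r := by fun_prop
  set v : ℝ → ℝ := fun r => exp (-(m * r)) * ‖x₁ (t + σ * r) - x₂ (t + σ * r)‖ + δ with hv
  have cv : Continuous v := by
    have hx₁ : Continuous fun r => x₁ (t + σ * r) := cx₁.comp haff
    have hx₂ : Continuous fun r => x₂ (t + σ * r) := cx₂.comp haff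
    fun_prop
  have hint : ∀ τ, 0 ≤ τ → v τ ≤ δ + K * ε * ∫ r in (0 : ℝ)..τ, v r := by
    intro τ hτ
    have hvc := hT.eq_integral_of_hasDerivAt hz cF (sub_eq_zero.2 h0) σ τ
    have hb : ‖x₁ (t + σ * τ) - x₂ (t + σ * τ)‖ ≤
        ∫ r in (0 : ℝ)..τ, exp (m * τ) * (K * ε) * v r := by
      rw [hvc]
      refine intervalIntegral.norm_integral_le_of_norm_le hτ
        (Eventually.of_forall fun r hr => ?_)
        ((continuous_const.mul cv).intervalIntegrable _ _)
      rw [norm_smul, norm_eq_abs, hσ, one_mul]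
      have hr0 : 0 ≤ r := hr.1.le
      have hτr : 0 ≤ τ - r := sub_nonneg.2 hr.2
      calc ‖T (t + σ * τ) (t + σ * r) (F (t + σ * r))‖
          ≤ ‖T (t + σ * τ) (t + σ * r)‖ * ‖F (t + σ * r)‖ := ContinuousLinearMap.le_opNorm _ _
        _ ≤ (K * exp (m * (τ - r))) *
            (ε * (‖x₁ (t + σ * r) - x₂ (t + σ * r)‖ + δ * exp (m * r))) := by
          gcongr
          · exact (hTb r τ hr.2).trans (by gcongr)
          · exact (hfl _ _ _ _ _).trans (by gcongr; exact hy r hr0)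
        _ = exp (m * τ) * (K * ε) * v r := by
          have e1 : exp (m * (τ - r)) = exp (m * τ) * exp (-(m * r)) := by
            rw [← exp_add]; ring_nf
          have e2 : exp (-(m * r)) * exp (m * r) = 1 := by rw [← exp_add]; simp
          simp only [hv, e1]
          linear_combination exp (m * τ) * K * ε * δ * e2
    rw [intervalIntegral.integral_const_mul] at hb
    have e3 : exp (-(m * τ)) * exp (m * τ) = 1 := by rw [← exp_add]; simp
    have := mul_le_mul_of_nonneg_left hb (exp_pos (-(m * τ))).le
    simp only [hv] at this ⊢
    linear_combination this + (K * ε * ∫ r in (0 : ℝ)..τ, v r) * e3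
  have key := le_mul_exp_of_le_add_mul_integral cv (fun r => by positivity) hδ0
    (mul_nonneg hK hε) hint hτ
  have e3 : exp (m * τ) * exp (-(m * τ)) = 1 := by rw [← exp_add]; simp
  have e4 : exp ((m + K * ε) * τ) = exp (m * τ) * exp (K * ε * τ) := by
    rw [← exp_add]; ring_nf
  have := mul_le_mul_of_nonneg_left key (exp_pos (m * τ)).le
  simp only [hv] at this
  rw [e4]
  linear_combination this + hy τ hτ - ‖x₁ (t + σ * τ) - x₂ (t + σ * τ)‖ * e3

lemma integrable_twoSided_exp {c₁ c₂ μ₁ μ₂ : ℝ} (h₁ : 0 < μ₁) (h₂ : 0 < μ₂) (t : ℝ) :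
    Integrable (fun s => if s ≤ t then c₁ * exp (-μ₁ * (t - s)) else c₂ * exp (-μ₂ * (s - t))) ∧
    (∫ s, if s ≤ t then c₁ * exp (-μ₁ * (t - s)) else c₂ * exp (-μ₂ * (s - t)))
      = c₁ / μ₁ + c₂ / μ₂ := by
  have e₁ : EqOn (fun s => c₁ * exp (-(μ₁ * t)) * exp (μ₁ * s)) (fun s => if s ≤ t then
      c₁ * exp (-μ₁ * (t - s)) else c₂ * exp (-μ₂ * (s - t))) (Iic t) := fun s hs => by
    simp only [if_pos (mem_Iic.1 hs), mul_assoc, ← exp_add]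
    ring_nf
  have e₂ : EqOn (fun s => c₂ * exp (μ₂ * t) * exp (-μ₂ * s)) (fun s => if s ≤ t then
      c₁ * exp (-μ₁ * (t - s)) else c₂ * exp (-μ₂ * (s - t))) (Ioi t) := fun s hs => by
    simp only [if_neg (not_le.2 (mem_Ioi.1 hs)), mul_assoc, ← exp_add]
    ring_nf
  have i₁ := IntegrableOn.congr_fun ((integrableOn_exp_mul_Iic h₁ t).const_mul
    (c₁ * exp (-(μ₁ * t)))) e₁ measurableSet_Iic
  have i₂ := IntegrableOn.congr_fun ((integrableOn_exp_mul_Ioi (neg_neg_of_pos h₂) t).const_mul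
    (c₂ * exp (μ₂ * t))) e₂ measurableSet_Ioi
  refine ⟨?_, ?_⟩
  · have := i₁.union i₂
    rwa [Iic_union_Ioi, integrableOn_univ] at this
  · rw [← intervalIntegral.integral_Iic_add_Ioi i₁ i₂, ← setIntegral_congr_fun measurableSet_Iic e₁,
      ← setIntegral_congr_fun measurableSet_Ioi e₂, integral_const_mul, integral_const_mul,
      integral_exp_mul_Iic h₁, integral_exp_mul_Ioi (neg_neg_of_pos h₂)]
    have a₁ : exp (-(μ₁ * t)) * exp (μ₁ * t) = 1 := by rw [← exp_add]; simp
    have a₂ : exp (μ₂ * t) * exp (-μ₂ * t) = 1 := by rw [← exp_add]; simp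
    have := h₁.ne'
    have := h₂.ne'
    linear_combination (c₁ / μ₁) * a₁ + (c₂ / μ₂) * a₂

lemma norm_green_apply_le {P : ℝ → X →L[ℝ] X} {D₁ D₂ lam₁ lam₂ : ℝ}
    (h₁ : ∀ t s, s ≤ t → ‖(T t s).comp (P s)‖ ≤ D₁ * exp (-lam₁ * (t - s)))
    (h₂ : ∀ t s, s ≤ t →
      ‖(T s t).comp (ContinuousLinearMap.id ℝ X - P t)‖ ≤ D₂ * exp (-lam₂ * (t - s)))
    (t s : ℝ) (ξ : X) :
    ‖Green T P t s ξ‖ ≤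
      (if s ≤ t then D₁ * exp (-lam₁ * (t - s)) else D₂ * exp (-lam₂ * (s - t))) * ‖ξ‖ := by
  refine (ContinuousLinearMap.le_opNorm _ _).trans
    (mul_le_mul_of_nonneg_right ?_ (norm_nonneg _))
  unfold Green
  split_ifs with h
  · exact h₁ t s h
  · rw [norm_neg]
    exact h₂ s t (not_le.1 h).le

lemma IsEvolutionFamily.aestronglyMeasurable_green [FiniteDimensional ℝ X]
    (hT : IsEvolutionFamily A T) {P : ℝ → X →L[ℝ] X}
    (hcomm : ∀ t s, (T t s).comp (P s) = (P t).comp (T t s)) (t : ℝ) {F : ℝ → X}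
    (hF : Continuous F) : AEStronglyMeasurable (fun s => Green T P t s (F s)) := by
  have cT : Continuous fun s => T t s (F s) := (hT.continuous_right t).clm_apply hF
  have hG : (fun s => Green T P t s (F s)) = (Iic t).piecewise
      (fun s => P t (T t s (F s))) (fun s => -(T t s (F s) - P t (T t s (F s)))) := by
    funext s
    have hc : T t s (P s (F s)) = P t (T t s (F s)) := congrArg (fun S => S (F s)) (hcomm t s)
    by_cases h : s ≤ t <;> simp [Green, Set.piecewise, h, hc]
  rw [hG]
  have cP : Continuous fun s => P t (T t s (F s)) := (P t).continuous.comp cT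
  exact AEStronglyMeasurable.piecewise measurableSet_Iic cP.aestronglyMeasurable
    (cT.sub cP).neg.aestronglyMeasurable

/-- Interpolation between the Lipschitz bound and the sup bound. -/
lemma le_rpow_interpolation {u b B α : ℝ} (hu : 0 ≤ u) (hb : u ≤ b) (hB : u ≤ B) (hα0 : 0 ≤ α)
    (hα1 : α ≤ 1) : u ≤ b ^ (1 - α) * B ^ α := by
  rcases hu.eq_or_lt with rfl | hu'
  · positivity
  calc u = u ^ (1 - α) * u ^ α := by rw [← rpow_add hu']; simp
    _ ≤ b ^ (1 - α) * B ^ α := by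
      have : 0 ≤ 1 - α := sub_nonneg.2 hα1
      have : 0 ≤ b := hu.trans hb
      gcongr

end Helpers

theorem holder_in_y_of_hbar_under_exponential_dichotomy
    {d : ℕ} {Y : Type*} [NormedAddCommGroup Y] [NormedSpace ℝ Y] [CompleteSpace Y]
    (A : ℝ → Euc d →L[ℝ] Euc d) (hA : Continuous A)
    (T : ℝ → ℝ → Euc d →L[ℝ] Euc d) (hT : IsEvolutionFamily A T)
    -- the projections and the dichotomy / bounded growth and decay estimates
    (P : ℝ → Euc d →L[ℝ] Euc d) (hproj : ∀ t, (P t).comp (P t) = P t)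
    (hcomm : ∀ t s, (T t s).comp (P s) = (P t).comp (T t s))
    (K₁ K₂ D₁ D₂ lam₁ lam₂ a₁ a₂ : ℝ)
    (hK₁ : 0 < K₁) (hK₂ : 0 < K₂) (hD₁ : 0 < D₁) (hD₂ : 0 < D₂)
    (hlam₁ : 0 < lam₁) (hlam₂ : 0 < lam₂) (ha₂ : lam₁ ≤ a₂) (ha₁ : lam₂ ≤ a₁)
    (hest₁ : ∀ t s, s ≤ t → ‖T t s‖ ≤ K₁ * exp (a₁ * (t - s)))
    (hest₂ : ∀ t s, s ≤ t → ‖T s t‖ ≤ K₂ * exp (a₂ * (t - s)))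
    (hest₃ : ∀ t s, s ≤ t → ‖(T t s).comp (P s)‖ ≤ D₁ * exp (-lam₁ * (t - s)))
    (hest₄ : ∀ t s, s ≤ t →
      ‖(T s t).comp (ContinuousLinearMap.id ℝ (Euc d) - P t)‖ ≤ D₂ * exp (-lam₂ * (t - s)))
    -- `f` and its bounds
    (f : ℝ → Euc d → Y → Euc d)
    (hf : Continuous fun p : ℝ × Euc d × Y => f p.1 p.2.1 p.2.2)
    (M : ℝ) (hM : 1 ≤ M) (hfb : ∀ t x y, ‖f t x y‖ ≤ M)
    (ε : ℝ) (hε : 0 < ε)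
    (hfl : ∀ (t : ℝ) (x₁ x₂ : Euc d) (y₁ y₂ : Y),
      ‖f t x₁ y₁ - f t x₂ y₂‖ ≤ ε * (‖x₁ - x₂‖ + ‖y₁ - y₂‖))
    -- `g` is Lipschitz, with flow `Φ`
    (g : ℝ → Y → Y) (hg : Continuous fun p : ℝ × Y => g p.1 p.2)
    (M₂ : ℝ) (hM₂ : 0 < M₂)
    (hgl : ∀ (t : ℝ) (y w : Y), ‖g t y - g t w‖ ≤ M₂ * ‖y - w‖)
    (Φ : ℝ → ℝ → Y → Y)
    (hΦ : ∀ (τ : ℝ) (η : Y),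
      (∀ t, HasDerivAt (fun r => Φ r τ η) (g t (Φ t τ η)) t) ∧ Φ τ τ η = η)
    (hgU : ∀ y w : ℝ → Y, (∀ t, HasDerivAt y (g t (y t)) t) →
      (∀ t, HasDerivAt w (g t (w t)) t) → ∀ τ, y τ = w τ → y = w)
    -- `Ψ` is the `x`-component of the flow of the coupled system (2nl)
    (Ψ : ℝ → ℝ → Euc d → Y → Euc d)
    (hΨ : ∀ (τ : ℝ) (ξ : Euc d) (η : Y),
      IsSolNL A f g (fun t => Ψ t τ ξ η) (fun t => Φ t τ η) ∧ Ψ τ τ ξ η = ξ)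
    -- the smallness condition implying the existence of the conjugacy
    (hsmall : (D₁ / lam₁ + D₂ / lam₂) * ε < 1)
    -- `h̄` is the conjugacy from the linearization theorem
    (hbar : ℝ → Euc d → Y → Euc d)
    (hbarfix : ∀ (τ : ℝ) (ξ : Euc d) (η : Y), hbar τ ξ η =
      -∫ s, Green T P τ s (f s (Ψ s τ ξ η) (Φ s τ η)))
    -- the Hölder data
    (C α : ℝ) (hC : 0 < C) (hα0 : 0 < α)
    (hαM₃ : α < min (lam₁ / max M₂ (max a₁ a₂)) (lam₂ / max M₂ (max a₁ a₂)))
    (hα : α < min (lam₁ / (max M₂ (max a₁ a₂) + K₂ * ε))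
                  (lam₂ / (max M₂ (max a₁ a₂) + K₁ * ε)))
    (hcond : 2 ^ (1 + α) * M * ε ^ α *
      (D₁ / (lam₁ - α * (max M₂ (max a₁ a₂) + K₂ * ε)) +
       D₂ / (lam₂ - α * (max M₂ (max a₁ a₂) + K₁ * ε))) ≤ C) :
    ∀ (t : ℝ) (x : Euc d) (y₁ y₂ : Y), ‖hbar t x y₁ - hbar t x y₂‖ ≤ C * ‖y₁ - y₂‖ ^ α := by
  intro t x y₁ y₂
  set m := max M₂ (max a₁ a₂) with hm
  have hM₂m : M₂ ≤ m := le_max_left _ _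
  have ha₁m : a₁ ≤ m := (le_max_left _ _).trans (le_max_right _ _)
  have ha₂m : a₂ ≤ m := (le_max_right _ _).trans (le_max_right _ _)
  have hm0 : 0 < m := hM₂.trans_le hM₂m
  have hα1 : α ≤ 1 :=
    (hαM₃.le.trans (min_le_left _ _)).trans ((div_le_one hm0).2 (ha₂.trans ha₂m))
  have hμ₁ : 0 < lam₁ - α * (m + K₂ * ε) := by
    have := (lt_div_iff₀ (by positivity)).1 (hα.trans_le (min_le_left _ _))
    linarith
  have hμ₂ : 0 < lam₂ - α * (m + K₁ * ε) := by
    have := (lt_div_iff₀ (by positivity)).1 (hα.trans_le (min_le_right _ _))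
    linarith
  set δ := ‖y₁ - y₂‖ with hδ
  have hδ0 : 0 ≤ δ := norm_nonneg _
  set F : Y → ℝ → Euc d := fun η s => f s (Ψ s t x η) (Φ s t η) with hF
  have cF : ∀ η, Continuous (F η) := fun η =>
    hf.comp (continuous_id.prodMk
      ((continuous_iff_continuousAt.2 fun s => ((hΨ t x η).1.1 s).continuousAt).prodMk
        (continuous_iff_continuousAt.2 fun s => ((hΦ t η).1 s).continuousAt)))
  have iG : ∀ η, Integrable fun s => Green T P t s (F η s) := fun η => by
    refine ((integrable_twoSided_exp (c₁ := D₁) (c₂ := D₂) hlam₁ hlam₂ t).1.mul_const M).mono'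
      (hT.aestronglyMeasurable_green hcomm t (cF η)) (Filter.Eventually.of_forall fun s => ?_)
    refine (norm_green_apply_le hest₃ hest₄ t s _).trans
      (mul_le_mul_of_nonneg_left (hfb _ _ _) ?_)
    split_ifs <;> positivity
  -- separation of the two trajectories, forwards and backwards in time
  have hsep : ∀ (σ : ℝ) (K a : ℝ), |σ| = 1 → 0 ≤ K → a ≤ m →
      (∀ r τ, r ≤ τ → ‖T (t + σ * τ) (t + σ * r)‖ ≤ K * exp (a * (τ - r))) →
      ∀ τ, 0 ≤ τ → ‖F y₁ (t + σ * τ) - F y₂ (t + σ * τ)‖ ≤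
        2 ^ (1 + α) * M * ε ^ α * δ ^ α * exp (α * ((m + K * ε) * τ)) := by
    intro σ K a hσ hK ham hTb τ hτ
    have h := hT.norm_sub_add_norm_sub_le hf hε.le hfl hgl (hΨ t x y₁).1 (hΨ t x y₂).1
      (by rw [(hΨ t x y₁).2, (hΨ t x y₂).2]) hσ hK ham hM₂m hTb hτ
    rw [(hΦ t y₁).2, (hΦ t y₂).2] at h
    have h2M : ‖F y₁ (t + σ * τ) - F y₂ (t + σ * τ)‖ ≤ 2 * M := by
      refine (norm_sub_le _ _).trans ?_
      linarith [hfb (t + σ * τ) (Ψ (t + σ * τ) t x y₁) (Φ (t + σ * τ) t y₁),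
        hfb (t + σ * τ) (Ψ (t + σ * τ) t x y₂) (Φ (t + σ * τ) t y₂)]
    have hlip : ‖F y₁ (t + σ * τ) - F y₂ (t + σ * τ)‖ ≤
        ε * (δ * exp ((m + K * ε) * τ)) :=
      (hfl _ _ _ _ _).trans (mul_le_mul_of_nonneg_left h hε.le)
    refine (le_rpow_interpolation (norm_nonneg _) h2M hlip hα0.le hα1).trans ?_
    rw [mul_rpow hε.le (by positivity), mul_rpow hδ0 (exp_pos _).le, ← exp_mul,
      mul_comm _ α, ← mul_assoc, ← mul_assoc]
    have hc : (2 * M) ^ (1 - α) ≤ 2 ^ (1 + α) * M := by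
      rw [mul_rpow (by norm_num) (by linarith)]
      have e1 : (2 : ℝ) ^ (1 - α) ≤ 2 ^ (1 + α) :=
        rpow_le_rpow_of_exponent_le (by norm_num) (by linarith)
      have e2 : M ^ (1 - α) ≤ M := by
        simpa using rpow_le_rpow_of_exponent_le hM (show 1 - α ≤ 1 by linarith)
      gcongr
    gcongr
  set B := 2 ^ (1 + α) * M * ε ^ α * δ ^ α with hB
  have hB0 : 0 ≤ B := by positivity
  have hbound : ∀ s, ‖Green T P t s (F y₁ s) - Green T P t s (F y₂ s)‖ ≤
      if s ≤ t then (D₁ * B) * exp (-(lam₁ - α * (m + K₂ * ε)) * (t - s))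
      else (D₂ * B) * exp (-(lam₂ - α * (m + K₁ * ε)) * (s - t)) := by
    intro s
    rw [← map_sub]
    refine (norm_green_apply_le hest₃ hest₄ t s _).trans ?_
    split_ifs with hs
    · have h := hsep (-1) K₂ a₂ (by norm_num) hK₂.le ha₂m
        (fun r τ h => by
          convert hest₂ (t + -1 * r) (t + -1 * τ) (by linarith) using 3
          ring) (t - s) (by linarith)
      rw [show t + -1 * (t - s) = s by ring] at h
      refine (mul_le_mul_of_nonneg_left h (by positivity)).trans_eq ?_
      rw [show -(lam₁ - α * (m + K₂ * ε)) * (t - s) =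
        -lam₁ * (t - s) + α * ((m + K₂ * ε) * (t - s)) by ring, exp_add]
      ring
    · have h := hsep 1 K₁ a₁ (by norm_num) hK₁.le ha₁m
        (fun r τ h => by
          convert hest₁ (t + 1 * τ) (t + 1 * r) (by linarith) using 3
          ring) (s - t) (by linarith)
      rw [show t + 1 * (s - t) = s by ring] at h
      refine (mul_le_mul_of_nonneg_left h (by positivity)).trans_eq ?_
      rw [show -(lam₂ - α * (m + K₁ * ε)) * (s - t) =
        -lam₂ * (s - t) + α * ((m + K₁ * ε) * (s - t)) by ring, exp_add]
      ring
  obtain ⟨ib, hb⟩ := integrable_twoSided_exp (c₁ := D₁ * B) (c₂ := D₂ * B) hμ₁ hμ₂ t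
  calc ‖hbar t x y₁ - hbar t x y₂‖
      = ‖∫ s, (Green T P t s (F y₁ s) - Green T P t s (F y₂ s))‖ := by
        rw [hbarfix, hbarfix, integral_sub (iG y₁) (iG y₂), ← norm_neg]
        congr 1
        abel
    _ ≤ D₁ * B / (lam₁ - α * (m + K₂ * ε)) + D₂ * B / (lam₂ - α * (m + K₁ * ε)) :=
        (norm_integral_le_of_norm_le ib (Filter.Eventually.of_forall hbound)).trans_eq hb
    _ = 2 ^ (1 + α) * M * ε ^ α * (D₁ / (lam₁ - α * (m + K₂ * ε)) +
          D₂ / (lam₂ - α * (m + K₁ * ε))) * δ ^ α := by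
        rw [hB]; ring
    _ ≤ C * δ ^ α := mul_le_mul_of_nonneg_right hcond (by positivity)
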